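/- Let A be a transitive model of ZFC, ℚ ∈ A, M ≺ A with ℚ ∈ M, and G an A-generic filter on ℚ. If N is an elementary submodel of A with M ⊆ N ⊆ M(G) (where M(G) = M[G] ∩ A), then N[G] = M[G]. -/

import Mathlib

open FirstOrder

namespace Paper

open scoped Classical

/-- Function symbols of the language: one unary symbol `U`. -/
inductive Funcs : ℕ → Type | U : Funcs 1

/-- Relation symbols of the language: one binary symbol `∈`. -/
inductive Rels : ℕ → Type | mem : Rels 2

/-- The language `ℒ` of set theory expanded by a unary function symbol `U`. -/
def L : Language := ⟨Funcs, Rels⟩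

/-- The `ℒ`-structure on a collection `A` of ZF-sets, interpreting `∈` as true membership
and the function symbol `U` by `u` (adjusted to be the identity where `u` leaves `A`). -/
noncomputable def zfStr (A : Set ZFSet) (u : ZFSet → ZFSet) : L.Structure ↥A where
  funMap {n} f v :=
    match f with
    | .U => if h : u (v 0 : ZFSet) ∈ A then ⟨u (v 0 : ZFSet), h⟩ else v 0
  RelMap {n} r v :=
    match r with
    | .mem => (v 0 : ZFSet) ∈ (v 1 : ZFSet)

/-- Satisfaction of a first-order `ℒ`-formula in the structure `(A, ∈, u)`. -/
noncomputable def Sat (A : Set ZFSet) (u : ZFSet → ZFSet) {n : ℕ}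
    (φ : L.Formula (Fin n)) (v : Fin n → ↥A) : Prop :=
  letI : L.Structure ↥A := zfStr A u
  φ.Realize v

/-- A collection of ZF-sets is transitive. -/
def IsTransitiveSet (A : Set ZFSet) : Prop := ∀ x ∈ A, ∀ y ∈ x, y ∈ A

/-- `x` is a (von Neumann) ordinal: a transitive set of transitive sets. -/
def IsOrd (x : ZFSet) : Prop := x.IsTransitive ∧ ∀ y ∈ x, ZFSet.IsTransitive y

/-- `M` is an elementary submodel of the structure `(A, ∈, u)`, via closure under the
interpretation of the symbols together with the Tarski–Vaught criterion. -/
structure IsElemSub (A : Set ZFSet) (u : ZFSet → ZFSet) (M : Set ZFSet) : Prop where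
  subset : M ⊆ A
  closedU : ∀ x ∈ M, u x ∈ M
  tv : ∀ (n : ℕ) (φ : L.Formula (Fin (n + 1))) (v : Fin n → ZFSet) (hv : ∀ i, v i ∈ M),
    (∃ a, ∃ ha : a ∈ A, Sat A u φ (Fin.cons ⟨a, ha⟩ fun i => ⟨v i, subset (hv i)⟩)) →
    ∃ a, ∃ haM : a ∈ M, Sat A u φ (Fin.cons ⟨a, subset haM⟩ fun i => ⟨v i, subset (hv i)⟩)

/-- The structure `(A, ∈, u)` satisfies ZFC: for a transitive carrier `A` (where
extensionality and foundation are automatic) this is the conjunction of pairing, union,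
power set, infinity, separation and replacement for first-order `ℒ`-formulas with
parameters, and choice. -/
structure SatZFC (A : Set ZFSet) (u : ZFSet → ZFSet) : Prop where
  pairing : ∀ x ∈ A, ∀ y ∈ A, ({x, y} : ZFSet) ∈ A
  union : ∀ x ∈ A, ZFSet.sUnion x ∈ A
  power : ∀ x ∈ A, ZFSet.sep (· ∈ A) (ZFSet.powerset x) ∈ A
  infinity : ZFSet.omega ∈ A
  separation : ∀ (n : ℕ) (φ : L.Formula (Fin (n + 1))) (v : Fin n → ↥A), ∀ x ∈ A,
    ZFSet.sep (fun z => ∃ h : z ∈ A, Sat A u φ (Fin.cons ⟨z, h⟩ v)) x ∈ A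
  replacement : ∀ (n : ℕ) (φ : L.Formula (Fin (n + 2))) (v : Fin n → ↥A), ∀ x ∈ A,
    (∀ z, ∀ h : z ∈ A, z ∈ x → ∃! w : ↥A, Sat A u φ (Fin.cons ⟨z, h⟩ (Fin.cons w v))) →
    ∃ b ∈ A, ∀ w, ∀ hw : w ∈ A,
      (w ∈ b ↔ ∃ z, ∃ h : z ∈ A, z ∈ x ∧ Sat A u φ (Fin.cons ⟨z, h⟩ (Fin.cons ⟨w, hw⟩ v)))
  choice : ∀ x ∈ A, (∀ y ∈ x, y ≠ (∅ : ZFSet)) →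
    ∃ f ∈ A, ∃ r, ZFSet.IsFunc x r f ∧ ∀ y ∈ x, ∀ z, ZFSet.pair y z ∈ f → z ∈ y

/-- An admissible structure `(A, ∈, u)`: `A` is transitive, `u` maps the ordinals of `A`
into `A`, and the structure satisfies ZFC in the expanded language. -/
structure Admissible (A : Set ZFSet) (u : ZFSet → ZFSet) : Prop where
  trans : IsTransitiveSet A
  ordMap : ∀ x ∈ A, IsOrd x → u x ∈ A
  zfc : SatZFC A u

/-- `A_α = A ∩ V_α`: the elements of `A` of rank below (the rank of) `α`. -/
def Ar (A : Set ZFSet) (α : ZFSet) : Set ZFSet := {x ∈ A | x.rank < α.rank}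

/-- `E_𝒜`: the set of ordinals `α ∈ A` such that `(A_α, ∈, u ↾ α)` is an elementary
submodel of `(A, ∈, u)`. -/
def Eset (A : Set ZFSet) (u : ZFSet → ZFSet) : Set ZFSet :=
  {α ∈ A | IsOrd α ∧ IsElemSub A u (Ar A α)}

/-- The supremum of the ranks of the members of a collection of ZF-sets. -/
noncomputable def osup (S : Set ZFSet) : Ordinal := sSup (ZFSet.rank '' S)

end Paper

namespace Paper

/-- The von Neumann natural number `n` as a ZF-set. -/
def natToZF : ℕ → ZFSet
  | 0 => ∅
  | n + 1 => insert (natToZF n) (natToZF n)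

/-- `t` is a finite tuple from `X`: a function whose domain is a natural number and whose
values lie in `X`; this codes the elements of `X^{<ω}`. -/
def IsFinTuple (X : Set ZFSet) (t : ZFSet) : Prop :=
  (∃ n : ℕ, ∃ r, ZFSet.IsFunc (natToZF n) r t) ∧
    ∀ i z : ZFSet, ZFSet.pair i z ∈ t → z ∈ X

/-- `f` is a (set) function. -/
def IsZFFun (f : ZFSet) : Prop := ∃ d r, ZFSet.IsFunc d r f

/-- `Hull(M, X)`: the set of all values `f(x̄)` where `f ∈ M` is a function and `x̄` is a
finite tuple from `X` lying in the domain of `f`. -/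
def Hull (M X : Set ZFSet) : Set ZFSet :=
  {z | ∃ f ∈ M, IsZFFun f ∧ ∃ t, IsFinTuple X t ∧ ZFSet.pair t z ∈ f}

/-- `A ∩ V_o` for an ordinal `o`: the elements of `A` of rank below `o`. -/
def ArO (A : Set ZFSet) (o : Ordinal) : Set ZFSet := {x ∈ A | x.rank < o}

end Paper

namespace Paper

open scoped Classical

/-- Well-foundedness of the rank order on ZF-sets. -/
theorem rankWf : WellFounded (fun a b : ZFSet => a.rank < b.rank) :=
  InvImage.wf ZFSet.rank wellFounded_lt

/-- The interpretation `τ_G` of a name `τ` by a filter `G`, defined by recursion: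
`val G τ = { val G σ : ∃ p ∈ G, (p, σ) ∈ τ }`. -/
noncomputable def val (G : Set ZFSet) : ZFSet → ZFSet :=
  rankWf.fix fun τ ih =>
    @ZFSet.image (fun σ => if h : σ.rank < τ.rank then ih σ h else ∅)
      (Classical.allZFSetDefinable _)
      (ZFSet.sep (fun σ => ∃ p ∈ G, ZFSet.pair p σ ∈ τ)
        (ZFSet.sUnion (ZFSet.sUnion τ)))

/-- `τ` is a `ℚ`-name: every element of `τ` is a pair `(p, σ)` with `p ∈ Q` and `σ` a
`ℚ`-name. -/
def IsName (Q : ZFSet) : ZFSet → Prop :=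
  rankWf.fix fun τ ih =>
    ∀ x ∈ τ, ∃ p σ, p ∈ Q ∧ x = ZFSet.pair p σ ∧ ∃ h : σ.rank < τ.rank, ih σ h

/-- `(Q, R)` is a forcing notion: `R ⊆ Q × Q` codes a preorder on `Q`
(`(p, q) ∈ R` meaning `p ≤ q`). -/
structure IsForcingPoset (Q R : ZFSet) : Prop where
  sub : R ⊆ Q.prod Q
  refl : ∀ p ∈ Q, ZFSet.pair p p ∈ R
  trans : ∀ p q r : ZFSet, ZFSet.pair p q ∈ R → ZFSet.pair q r ∈ R → ZFSet.pair p r ∈ R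

/-- `p ≤ q` in the forcing notion coded by `R`. -/
def leF (R p q : ZFSet) : Prop := ZFSet.pair p q ∈ R

/-- `D` is a dense subset of the forcing notion `(Q, R)`. -/
def DenseIn (Q R D : ZFSet) : Prop := D ⊆ Q ∧ ∀ p ∈ Q, ∃ q ∈ D.toSet, leF R q p

/-- `G` is an `A`-generic filter on the forcing notion `(Q, R)`: a filter meeting every
dense subset of `Q` that belongs to `A`. -/
structure IsGenericFilter (A : Set ZFSet) (Q R : ZFSet) (G : Set ZFSet) : Prop where
  sub : G ⊆ Q.toSet
  nonempty : G.Nonempty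
  upward : ∀ p ∈ G, ∀ q ∈ Q.toSet, leF R p q → q ∈ G
  directed : ∀ p ∈ G, ∀ q ∈ G, ∃ r ∈ G, leF R r p ∧ leF R r q
  generic : ∀ D : ZFSet, D ∈ A → DenseIn Q R D → ∃ p ∈ G, p ∈ D.toSet

/-- `M[G] = { τ_G : τ ∈ M a ℚ-name }`. -/
def extModel (G : Set ZFSet) (Q : ZFSet) (M : Set ZFSet) : Set ZFSet :=
  {z | ∃ τ ∈ M, IsName Q τ ∧ z = val G τ}

/-- `S ∩ ω₁`: the countable ordinals belonging to `S`. -/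
def ctblOrds (S : Set ZFSet) : Set ZFSet := {x ∈ S | IsOrd x ∧ x.toSet.Countable}

/-- `q` is `(M, ℚ)`-semigeneric: `q` forces `M[Ġ] ∩ ω₁ = M ∩ ω₁`, i.e. for every
`A`-generic filter `G` containing `q`, `M[G] ∩ ω₁ = M ∩ ω₁`. -/
def Semigeneric (A : Set ZFSet) (Q R q : ZFSet) (M : Set ZFSet) : Prop :=
  ∀ G : Set ZFSet, IsGenericFilter A Q R G → q ∈ G →
    ctblOrds (extModel G Q M) = ctblOrds M

end Paper

namespace Paper

open scoped Classical

/-- Parameter-free definability over `(A, ∈)`. -/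
def Dfn {A : Set ZFSet} {n : ℕ} (P : (Fin n → ↥A) → Prop) : Prop :=
  ∃ φ : L.Formula (Fin n), ∀ v, Sat A id φ v ↔ P v

section
variable {A : Set ZFSet}

theorem D_congr {n : ℕ} {P Q : (Fin n → ↥A) → Prop} (h : Dfn Q) (hPQ : ∀ v, P v ↔ Q v) :
    Dfn P := by
  obtain ⟨φ, hφ⟩ := h
  exact ⟨φ, fun v => (hφ v).trans (hPQ v).symm⟩

theorem D_not {n : ℕ} {P : (Fin n → ↥A) → Prop} (h : Dfn P) : Dfn fun v => ¬ P v := by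
  obtain ⟨φ, hφ⟩ := h
  refine ⟨φ.not, fun v => ?_⟩
  show _ ↔ ¬ P v
  rw [← hφ v]
  simp only [Sat, Language.Formula.realize_not]

theorem D_imp {n : ℕ} {P Q : (Fin n → ↥A) → Prop} (h : Dfn P) (h' : Dfn Q) :
    Dfn fun v => P v → Q v := by
  obtain ⟨φ, hφ⟩ := h
  obtain ⟨ψ, hψ⟩ := h'
  refine ⟨φ.imp ψ, fun v => ?_⟩
  show _ ↔ (P v → Q v)
  rw [← hφ v, ← hψ v]
  simp only [Sat, Language.Formula.realize_imp]

theorem D_and {n : ℕ} {P Q : (Fin n → ↥A) → Prop} (h : Dfn P) (h' : Dfn Q) :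
    Dfn fun v => P v ∧ Q v :=
  D_congr (D_not (D_imp h (D_not h'))) fun v => by tauto

theorem D_or {n : ℕ} {P Q : (Fin n → ↥A) → Prop} (h : Dfn P) (h' : Dfn Q) :
    Dfn fun v => P v ∨ Q v :=
  D_congr (D_imp (D_not h) h') fun v => by tauto

theorem D_iff {n : ℕ} {P Q : (Fin n → ↥A) → Prop} (h : Dfn P) (h' : Dfn Q) :
    Dfn fun v => (P v ↔ Q v) :=
  D_congr (D_and (D_imp h h') (D_imp h' h)) fun v => by tauto

theorem D_ex {n : ℕ} {P : (Fin n → ↥A) → ↥A → Prop}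
    (h : Dfn fun v : Fin (n + 1) → ↥A => P (fun i => v i.succ) (v 0)) :
    Dfn fun v => ∃ a, P v a := by
  obtain ⟨φ, hφ⟩ := h
  let _ : L.Structure ↥A := zfStr A id
  let g : Fin (n + 1) → Fin n ⊕ Fin 1 := Fin.cases (Sum.inr 0) Sum.inl
  refine ⟨Language.Formula.iExs (Fin 1) (φ.relabel g), fun v => ?_⟩
  have key : ∀ i : Fin 1 → ↥A, (φ.relabel g).Realize (Sum.elim v i) ↔ P v (i 0) := by
    intro i
    rw [Language.Formula.realize_relabel]
    exact hφ _
  unfold Sat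
  rw [Language.Formula.realize_iExs]
  simp only [key]
  exact ⟨fun ⟨i, hi⟩ => ⟨_, hi⟩, fun ⟨a, ha⟩ => ⟨fun _ => a, ha⟩⟩

theorem D_all {n : ℕ} {P : (Fin n → ↥A) → ↥A → Prop}
    (h : Dfn fun v : Fin (n + 1) → ↥A => P (fun i => v i.succ) (v 0)) :
    Dfn fun v => ∀ a, P v a :=
  D_congr (D_not (D_ex (P := fun v a => ¬ P v a) (D_not h))) fun v => by simp

theorem D_eq {n : ℕ} (i j : Fin n) : Dfn fun v : Fin n → ↥A => v i = v j := by
  let _ : L.Structure ↥A := zfStr A id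
  refine ⟨Language.Term.equal (Language.Term.var i) (Language.Term.var j), fun v => ?_⟩
  unfold Sat
  rw [Language.Formula.realize_equal]
  rfl

theorem D_mem {n : ℕ} (i j : Fin n) :
    Dfn fun v : Fin n → ↥A => (v i : ZFSet) ∈ (v j : ZFSet) := by
  let _ : L.Structure ↥A := zfStr A id
  refine ⟨Language.Relations.formula₂ (L := L) (Rels.mem : L.Relations 2)
    (Language.Term.var i) (Language.Term.var j), fun v => ?_⟩
  exact Language.Formula.realize_rel₂ (L := L)

theorem A_ext (hT : IsTransitiveSet A) {x y : ↥A}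
    (h : ∀ z : ↥A, (z : ZFSet) ∈ (x : ZFSet) ↔ (z : ZFSet) ∈ (y : ZFSet)) : x = y := by
  apply Subtype.ext
  ext z
  exact ⟨fun hz => (h ⟨z, hT _ x.2 _ hz⟩).1 hz, fun hz => (h ⟨z, hT _ y.2 _ hz⟩).2 hz⟩

theorem D_upair (hT : IsTransitiveSet A) {n : ℕ} (i j k : Fin n) :
    Dfn fun v : Fin n → ↥A => (v i : ZFSet) = {(v j : ZFSet), (v k : ZFSet)} := by
  have : Dfn fun v : Fin n → ↥A => ∀ w : ↥A, (w : ZFSet) ∈ (v i : ZFSet) ↔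
      (w = v j ∨ w = v k) := by
    repeat' first | apply D_eq | apply D_mem | apply D_or | apply D_iff | apply D_all
  refine D_congr this fun v => ⟨fun h w => by rw [h]; simp [Subtype.ext_iff], fun h => ?_⟩
  ext z
  simp only [ZFSet.mem_pair]
  constructor
  · intro hz
    simpa [Subtype.ext_iff] using (h ⟨z, hT _ (v i).2 _ hz⟩).1 hz
  · rintro (rfl | rfl)
    · exact (h _).2 (Or.inl rfl)
    · exact (h _).2 (Or.inr rfl)

theorem pair_eq (x y : ZFSet) : ZFSet.pair x y = {({x, x} : ZFSet), ({x, y} : ZFSet)} := by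
  simp [ZFSet.pair]

theorem pair_mem_A (hZ : SatZFC A id) {x y : ZFSet} (hx : x ∈ A) (hy : y ∈ A) :
    ZFSet.pair x y ∈ A := by
  rw [pair_eq]
  exact hZ.pairing _ (hZ.pairing _ hx _ hx) _ (hZ.pairing _ hx _ hy)

theorem of_pair_mem_A (hT : IsTransitiveSet A) {x y : ZFSet} (h : ZFSet.pair x y ∈ A) :
    x ∈ A ∧ y ∈ A := by
  rw [pair_eq] at h
  have h1 : ({x, y} : ZFSet) ∈ A := hT _ h _ (by simp)
  exact ⟨hT _ h1 _ (by simp), hT _ h1 _ (by simp)⟩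

theorem D_pair (hT : IsTransitiveSet A) (hZ : SatZFC A id) {n : ℕ} (i j k : Fin n) :
    Dfn fun v : Fin n → ↥A => (v i : ZFSet) = ZFSet.pair (v j : ZFSet) (v k : ZFSet) := by
  have : Dfn fun v : Fin n → ↥A => ∃ s t : ↥A, (s : ZFSet) = {(v j : ZFSet), (v j : ZFSet)} ∧
      (t : ZFSet) = {(v j : ZFSet), (v k : ZFSet)} ∧ (v i : ZFSet) = {(s : ZFSet), (t : ZFSet)} := by
    repeat' first | apply D_upair hT | apply D_and | apply D_ex
  refine D_congr this fun v => ?_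
  rw [pair_eq]
  constructor
  · intro h
    exact ⟨⟨_, hZ.pairing _ (v j).2 _ (v j).2⟩, ⟨_, hZ.pairing _ (v j).2 _ (v k).2⟩, rfl, rfl, h⟩
  · rintro ⟨s, t, hs, ht, h⟩
    rw [h, hs, ht]

theorem D_pairmem (hT : IsTransitiveSet A) (hZ : SatZFC A id) {n : ℕ} (i j k : Fin n) :
    Dfn fun v : Fin n → ↥A => ZFSet.pair (v i : ZFSet) (v j : ZFSet) ∈ (v k : ZFSet) := by
  have : Dfn fun v : Fin n → ↥A => ∃ s : ↥A, (s : ZFSet) = ZFSet.pair (v i : ZFSet) (v j : ZFSet) ∧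
      (s : ZFSet) ∈ (v k : ZFSet) := by
    repeat' first | apply D_mem | apply D_pair hT hZ | apply D_and | apply D_ex
  refine D_congr this fun v => ⟨fun h => ⟨⟨_, pair_mem_A hZ (v i).2 (v j).2⟩, rfl, h⟩, ?_⟩
  rintro ⟨s, hs, h⟩
  rwa [← hs]

/-- The ordered triple. -/
def tri (x y z : ZFSet) : ZFSet := ZFSet.pair x (ZFSet.pair y z)

theorem D_tri (hT : IsTransitiveSet A) (hZ : SatZFC A id) {n : ℕ} (l i j k : Fin n) :
    Dfn fun v : Fin n → ↥A => (v l : ZFSet) = tri (v i : ZFSet) (v j : ZFSet) (v k : ZFSet) := by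
  have : Dfn fun v : Fin n → ↥A => ∃ s : ↥A, (s : ZFSet) = ZFSet.pair (v j : ZFSet) (v k : ZFSet) ∧
      (v l : ZFSet) = ZFSet.pair (v i : ZFSet) (s : ZFSet) := by
    repeat' first | apply D_mem | apply D_pair hT hZ | apply D_and | apply D_ex
  refine D_congr this fun v => ⟨fun h => ⟨⟨_, pair_mem_A hZ (v j).2 (v k).2⟩, rfl, h⟩, ?_⟩
  rintro ⟨s, hs, h⟩
  rw [h, hs, tri]

theorem tri_mem_A (hZ : SatZFC A id) {x y z : ZFSet} (hx : x ∈ A) (hy : y ∈ A) (hz : z ∈ A) :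
    tri x y z ∈ A := pair_mem_A hZ hx (pair_mem_A hZ hy hz)

theorem tri_inj {x y z x' y' z' : ZFSet} : tri x y z = tri x' y' z' ↔ x = x' ∧ y = y' ∧ z = z' := by
  simp [tri, ZFSet.pair_inj]

theorem D_trimem (hT : IsTransitiveSet A) (hZ : SatZFC A id) {n : ℕ} (i j k l : Fin n) :
    Dfn fun v : Fin n → ↥A => tri (v i : ZFSet) (v j : ZFSet) (v k : ZFSet) ∈ (v l : ZFSet) := by
  have : Dfn fun v : Fin n → ↥A =>
      ∃ s : ↥A, (s : ZFSet) = tri (v i : ZFSet) (v j : ZFSet) (v k : ZFSet) ∧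
      (s : ZFSet) ∈ (v l : ZFSet) := by
    repeat' first | apply D_mem | apply D_tri hT hZ | apply D_and | apply D_ex
  refine D_congr this fun v => ⟨fun h => ⟨⟨_, tri_mem_A hZ (v i).2 (v j).2 (v k).2⟩, rfl, h⟩, ?_⟩
  rintro ⟨s, hs, h⟩
  rwa [← hs]

/-- Separation in `A` for definable predicates. -/
theorem sepA (hT : IsTransitiveSet A) (hZ : SatZFC A id) {n : ℕ} (P : ↥A → (Fin n → ↥A) → Prop)
    (hD : Dfn fun v : Fin (n + 1) → ↥A => P (v 0) (fun i => v i.succ))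
    (v : Fin n → ↥A) (x : ↥A) :
    ∃ s : ↥A, ∀ z : ↥A, (z : ZFSet) ∈ (s : ZFSet) ↔ (z : ZFSet) ∈ (x : ZFSet) ∧ P z v := by
  obtain ⟨φ, hφ⟩ := hD
  refine ⟨⟨_, hZ.separation n φ v x x.2⟩, fun z => ?_⟩
  simp only [ZFSet.mem_sep]
  refine and_congr_right fun _ => ⟨?_, fun h => ⟨z.2, (hφ _).2 h⟩⟩
  rintro ⟨h, h'⟩
  exact (hφ _).1 h'

/-- Replacement in `A` for definable functional predicates. -/
theorem replA (hT : IsTransitiveSet A) (hZ : SatZFC A id) {n : ℕ}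
    (P : ↥A → ↥A → (Fin n → ↥A) → Prop)
    (hD : Dfn fun v : Fin (n + 2) → ↥A => P (v 0) (v 1) (fun i => v i.succ.succ))
    (v : Fin n → ↥A) (x : ↥A)
    (hu : ∀ z : ↥A, (z : ZFSet) ∈ (x : ZFSet) → ∃! w : ↥A, P z w v) :
    ∃ s : ↥A, ∀ w : ↥A, (w : ZFSet) ∈ (s : ZFSet) ↔
      ∃ z : ↥A, (z : ZFSet) ∈ (x : ZFSet) ∧ P z w v := by
  obtain ⟨φ, hφ⟩ := hD
  have hφ' : ∀ z w : ↥A, Sat A id φ (Fin.cons z (Fin.cons w v)) ↔ P z w v := fun z w => hφ _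
  obtain ⟨b, hb, h⟩ := hZ.replacement n φ v x x.2 (fun z hz hzx => by
    simpa only [hφ'] using hu ⟨z, hz⟩ hzx)
  refine ⟨⟨b, hb⟩, fun w => (h w w.2).trans ?_⟩
  constructor
  · rintro ⟨z, hz, hzx, hs⟩
    exact ⟨⟨z, hz⟩, hzx, (hφ' _ _).1 hs⟩
  · rintro ⟨z, hzx, hs⟩
    exact ⟨z, z.2, hzx, (hφ' _ _).2 hs⟩

theorem unionA (hZ : SatZFC A id) (x y : ↥A) : (x : ZFSet) ∪ (y : ZFSet) ∈ A :=
  hZ.union _ (hZ.pairing _ x.2 _ y.2)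

theorem insA (hZ : SatZFC A id) (x y : ↥A) :
    ∃ s : ↥A, ∀ z : ZFSet, z ∈ (s : ZFSet) ↔ z = (x : ZFSet) ∨ z ∈ (y : ZFSet) := by
  refine ⟨⟨_, unionA hZ ⟨_, hZ.pairing _ x.2 _ x.2⟩ y⟩, fun z => ?_⟩
  simp

/-- Products exist in `A`. -/
theorem prodA (hT : IsTransitiveSet A) (hZ : SatZFC A id) (x y : ↥A) :
    ∃ s : ↥A, ∀ z : ↥A, (z : ZFSet) ∈ (s : ZFSet) ↔
      ∃ a b : ↥A, (a : ZFSet) ∈ (x : ZFSet) ∧ (b : ZFSet) ∈ (y : ZFSet) ∧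
        (z : ZFSet) = ZFSet.pair a b := by
  obtain ⟨s, hs⟩ := sepA hT hZ (n := 2)
    (fun z v => ∃ a b : ↥A, (a : ZFSet) ∈ (v 0 : ZFSet) ∧ (b : ZFSet) ∈ (v 1 : ZFSet) ∧
        (z : ZFSet) = ZFSet.pair a b)
    (by repeat' first | apply D_mem | apply D_pair hT hZ | apply D_and | apply D_ex)
    ![x, y] ⟨_, hZ.power _ (hZ.power _ (unionA hZ x y))⟩
  refine ⟨s, fun z => (hs z).trans ⟨fun h => h.2, fun h => ⟨?_, h⟩⟩⟩
  obtain ⟨a, b, ha, hb, h⟩ := h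
  simp only [ZFSet.mem_sep, ZFSet.mem_powerset]
  refine ⟨fun u hu => ?_, z.2⟩
  simp only [ZFSet.mem_sep, ZFSet.mem_powerset]
  refine ⟨fun w hw => ?_, hT _ z.2 _ hu⟩
  rw [h, pair_eq] at hu
  simp only [ZFSet.mem_pair] at hu
  rw [ZFSet.mem_union]
  rcases hu with rfl | rfl <;> simp only [ZFSet.mem_pair] at hw <;> rcases hw with rfl | rfl <;> tauto

/-- Transitivity of an element of `A`. -/
def TrA (t : ↥A) : Prop :=
  ∀ y z : ↥A, (y : ZFSet) ∈ (t : ZFSet) → (z : ZFSet) ∈ (y : ZFSet) → (z : ZFSet) ∈ (t : ZFSet)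

/-- `t` is the least transitive set containing `y`. -/
def TcA (y t : ↥A) : Prop :=
  TrA t ∧ (y : ZFSet) ∈ (t : ZFSet) ∧ ∀ t' : ↥A, TrA t' → (y : ZFSet) ∈ (t' : ZFSet) →
    ∀ z : ↥A, (z : ZFSet) ∈ (t : ZFSet) → (z : ZFSet) ∈ (t' : ZFSet)

theorem D_Tr {n : ℕ} (i : Fin n) : Dfn fun v : Fin n → ↥A => TrA (v i) := by
  unfold TrA
  repeat' first | apply D_mem | apply D_imp | apply D_all

theorem D_Tc {n : ℕ} (i j : Fin n) : Dfn fun v : Fin n → ↥A => TcA (v i) (v j) := by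
  unfold TcA
  repeat' first | apply D_mem | apply D_Tr | apply D_and | apply D_imp | apply D_all

theorem exists_tr (hT : IsTransitiveSet A) (hZ : SatZFC A id) (x : ZFSet) :
    ∀ hx : x ∈ A, ∃ t : ↥A, TrA t ∧ x ∈ (t : ZFSet) := by
  induction x using ZFSet.inductionOn with
  | _ x ih =>
  intro hx
  have huniq : ∀ z : ↥A, (z : ZFSet) ∈ x → ∃! w : ↥A, TcA z w := by
    intro z hz
    obtain ⟨t, ht, hzt⟩ := ih z hz z.2
    obtain ⟨s, hs⟩ := sepA hT hZ (n := 1)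
      (fun u v => ∀ t' : ↥A, TrA t' → (v 0 : ZFSet) ∈ (t' : ZFSet) → (u : ZFSet) ∈ (t' : ZFSet))
      (by repeat' first | apply D_mem | apply D_Tr | apply D_and | apply D_imp | apply D_all)
      ![z] t
    have hs' : ∀ u : ↥A, (u : ZFSet) ∈ (s : ZFSet) ↔ (u : ZFSet) ∈ (t : ZFSet) ∧
      ∀ t' : ↥A, TrA t' → (z : ZFSet) ∈ (t' : ZFSet) → (u : ZFSet) ∈ (t' : ZFSet) := hs
    refine ⟨s, ⟨?_, ?_, ?_⟩, ?_⟩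
    · intro a b ha hb
      rw [hs'] at ha ⊢
      exact ⟨ht a b ha.1 hb, fun t' h1 h2 => h1 a b (ha.2 t' h1 h2) hb⟩
    · exact (hs' z).2 ⟨hzt, fun t' _ h => h⟩
    · intro t' h1 h2 u hu
      exact ((hs' u).1 hu).2 t' h1 h2
    · rintro w ⟨h1, h2, h3⟩
      apply A_ext hT
      intro u
      rw [hs']
      exact ⟨fun hu => ⟨h3 t ht hzt u hu, fun t' h1 h2 => h3 t' h1 h2 u hu⟩,
        fun hu => hu.2 w h1 h2⟩
  obtain ⟨b, hb⟩ := replA hT hZ (n := 0) (fun z w _ => TcA z w) (by apply D_Tc) ![] ⟨x, hx⟩ huniq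
  obtain ⟨s, hs⟩ := insA hZ ⟨x, hx⟩ ⟨_, hZ.union _ b.2⟩
  refine ⟨s, ?_, (hs _).2 (Or.inl rfl)⟩
  intro y z hy hz
  rw [hs] at hy ⊢
  right
  simp only [ZFSet.mem_sUnion] at hy ⊢
  rcases hy with hy | ⟨c, hc, hyc⟩
  · have hzx : (z : ZFSet) ∈ x := by rw [← hy]; exact hz
    obtain ⟨w, hw, -⟩ := huniq z hzx
    exact ⟨w, (hb w).2 ⟨z, hzx, hw⟩, hw.2.1⟩
  · have hcA : c ∈ A := hT _ b.2 _ hc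
    obtain ⟨z', _, hw⟩ := (hb ⟨c, hcA⟩).1 hc
    exact ⟨c, hc, hw.1 y z hyc hz⟩

/-- Internal version of being a name. -/
def NmA (Q x : ↥A) : Prop :=
  ∃ S : ↥A, (x : ZFSet) ∈ (S : ZFSet) ∧ ∀ y z : ↥A, (y : ZFSet) ∈ (S : ZFSet) →
    (z : ZFSet) ∈ (y : ZFSet) → ∃ p s : ↥A, (p : ZFSet) ∈ (Q : ZFSet) ∧
      (s : ZFSet) ∈ (S : ZFSet) ∧ (z : ZFSet) = ZFSet.pair p s

theorem D_Nm (hT : IsTransitiveSet A) (hZ : SatZFC A id) {n : ℕ} (i j : Fin n) :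
    Dfn fun v : Fin n → ↥A => NmA (v i) (v j) := by
  unfold NmA
  repeat' first | apply D_mem | apply D_pair hT hZ | apply D_and | apply D_ex | apply D_imp | apply D_all

theorem rank_pair_mem {p s t : ZFSet} (h : ZFSet.pair p s ∈ t) : s.rank < t.rank := by
  have h1 : s ∈ ({p, s} : ZFSet) := by simp
  have h2 : ({p, s} : ZFSet) ∈ ZFSet.pair p s := by simp [ZFSet.pair]
  exact (ZFSet.rank_lt_of_mem h1).trans ((ZFSet.rank_lt_of_mem h2).trans (ZFSet.rank_lt_of_mem h))

theorem isName_iff (Q t : ZFSet) : IsName Q t ↔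
    ∀ x ∈ t, ∃ p s, p ∈ Q ∧ x = ZFSet.pair p s ∧ IsName Q s := by
  unfold IsName
  rw [WellFounded.fix_eq]
  refine forall₂_congr fun x hx => ?_
  constructor
  · rintro ⟨p, s, hp, rfl, _, h⟩
    exact ⟨p, s, hp, rfl, h⟩
  · rintro ⟨p, s, hp, rfl, h⟩
    exact ⟨p, s, hp, rfl, rank_pair_mem hx, h⟩

theorem mem_val (G : Set ZFSet) (t z : ZFSet) : z ∈ val G t ↔
    ∃ p ∈ G, ∃ s, ZFSet.pair p s ∈ t ∧ z = val G s := by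
  unfold val
  rw [WellFounded.fix_eq]
  rw [@ZFSet.mem_image]
  simp only [ZFSet.mem_sep, ZFSet.mem_sUnion]
  constructor
  · rintro ⟨s, ⟨-, p, hp, hs⟩, rfl⟩
    exact ⟨p, hp, s, hs, by rw [dif_pos (rank_pair_mem hs)]⟩
  · rintro ⟨p, hp, s, hs, rfl⟩
    refine ⟨s, ⟨⟨{p, s}, ⟨_, hs, ?_⟩, ?_⟩, p, hp, hs⟩, by rw [dif_pos (rank_pair_mem hs)]⟩
    · simp [ZFSet.pair]
    · simp

theorem isName_of_NmA (hT : IsTransitiveSet A) (Q x : ↥A) (h : NmA Q x) : IsName Q x := by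
  obtain ⟨S, hxS, hS⟩ := h
  have : ∀ y : ZFSet, y ∈ (S : ZFSet) → IsName Q y := by
    intro y
    induction y using rankWf.induction with
    | _ y ih =>
    intro hy
    rw [isName_iff]
    intro z hz
    have hyA := hT _ S.2 _ hy
    obtain ⟨p, s, hp, hs, h⟩ := hS ⟨y, hyA⟩ ⟨z, hT _ hyA _ hz⟩ hy hz
    simp only at h
    subst h
    exact ⟨p, s, hp, rfl, ih s (rank_pair_mem hz) hs⟩
  exact this _ hxS

theorem NmA_of_isName (hT : IsTransitiveSet A) (hZ : SatZFC A id) (Q : ↥A) (x : ZFSet) :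
    ∀ hx : x ∈ A, IsName Q x → NmA Q ⟨x, hx⟩ := by
  induction x using rankWf.induction with
  | _ x ih =>
  intro hx hn
  obtain ⟨T, hTr, hxT⟩ := exists_tr hT hZ x hx
  obtain ⟨S0, hS0⟩ := sepA hT hZ (n := 1) (fun z v => NmA (v 0) z) (by apply D_Nm hT hZ) ![Q] T
  have hS0' : ∀ z : ↥A, (z : ZFSet) ∈ (S0 : ZFSet) ↔ (z : ZFSet) ∈ (T : ZFSet) ∧ NmA Q z := hS0
  obtain ⟨S, hS⟩ := insA hZ ⟨x, hx⟩ S0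
  have htr : ∀ y z p s : ↥A, (y : ZFSet) ∈ (T : ZFSet) → (z : ZFSet) ∈ (y : ZFSet) →
      (z : ZFSet) = ZFSet.pair p s → (s : ZFSet) ∈ (T : ZFSet) := by
    intro y z p s hy hz h
    have h1 : ({(p : ZFSet), (s : ZFSet)} : ZFSet) ∈ (z : ZFSet) := by rw [h]; simp [ZFSet.pair]
    have h2 := hTr y z hy hz
    have h3 := hTr z ⟨_, hZ.pairing _ p.2 _ s.2⟩ h2 h1
    exact hTr ⟨_, hZ.pairing _ p.2 _ s.2⟩ s h3 (by simp)
  refine ⟨S, (hS _).2 (Or.inl rfl), ?_⟩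
  intro y z hy hz
  rcases (hS _).1 hy with h | h
  · simp only at h
    have hz' : (z : ZFSet) ∈ x := by rw [← h]; exact hz
    obtain ⟨p, s, hp, hzs, hs⟩ := (isName_iff _ _).1 hn z hz'
    have hA := of_pair_mem_A hT (hzs ▸ z.2)
    refine ⟨⟨p, hA.1⟩, ⟨s, hA.2⟩, hp, (hS _).2 (Or.inr ((hS0' _).2 ⟨?_, ?_⟩)), hzs⟩
    · exact htr ⟨x, hx⟩ z ⟨p, hA.1⟩ ⟨s, hA.2⟩ hxT hz' hzs
    · exact ih s (rank_pair_mem (hzs ▸ hz')) hA.2 hs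
  · obtain ⟨hyT, S', hyS', hS'⟩ := (hS0' y).1 h
    obtain ⟨p, s, hp, hs, hzs⟩ := hS' y z hyS' hz
    exact ⟨p, s, hp, (hS _).2 (Or.inr ((hS0' _).2 ⟨htr y z p s hyT hz hzs, S', hs, hS'⟩)), hzs⟩

/-- The order of the forcing on elements of `A`. -/
def leA (R p q : ↥A) : Prop := ZFSet.pair (p : ZFSet) (q : ZFSet) ∈ (R : ZFSet)

/-- The clause of the recursion for `p ⊩ s = x̌`. -/
def Phi (R : ↥A) (H : ↥A → ↥A → ↥A → Prop) (p s x : ↥A) : Prop :=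
  (∀ r π q : ↥A, ZFSet.pair (r : ZFSet) (π : ZFSet) ∈ (s : ZFSet) → leA R q p → leA R q r →
    ∃ q' y : ↥A, leA R q' q ∧ (y : ZFSet) ∈ (x : ZFSet) ∧ H q' π y) ∧
  (∀ y q : ↥A, (y : ZFSet) ∈ (x : ZFSet) → leA R q p →
    ∃ q' r π : ↥A, leA R q' q ∧ ZFSet.pair (r : ZFSet) (π : ZFSet) ∈ (s : ZFSet) ∧
      leA R q' r ∧ H q' π y)

/-- `p ⊩ s = x̌`, via certificates. -/
def Fc (R p s x : ↥A) : Prop :=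
  ∃ W : ↥A, tri p s x ∈ (W : ZFSet) ∧ ∀ p' s' x' : ↥A, tri p' s' x' ∈ (W : ZFSet) →
    Phi R (fun a b c => tri a b c ∈ (W : ZFSet)) p' s' x'

theorem D_le (hT : IsTransitiveSet A) (hZ : SatZFC A id) {n : ℕ} (i j k : Fin n) :
    Dfn fun v : Fin n → ↥A => leA (v i) (v j) (v k) := D_pairmem hT hZ j k i

theorem D_F (hT : IsTransitiveSet A) (hZ : SatZFC A id) {n : ℕ} (i j k l : Fin n) :
    Dfn fun v : Fin n → ↥A => Fc (v i) (v j) (v k) (v l) := by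
  unfold Fc Phi
  repeat' first
    | with_reducible apply D_mem
    | with_reducible apply D_le hT hZ
    | with_reducible apply D_trimem hT hZ
    | with_reducible apply D_pairmem hT hZ
    | with_reducible apply D_and
    | with_reducible apply D_ex
    | with_reducible apply D_imp
    | with_reducible apply D_all

theorem Phi_mono {R : ↥A} {H H' : ↥A → ↥A → ↥A → Prop} {p s x : ↥A}
    (h : Phi R H p s x)
    (hH : ∀ q q' r π y : ↥A, leA R q' q → ZFSet.pair (r : ZFSet) (π : ZFSet) ∈ (s : ZFSet) →
      (y : ZFSet) ∈ (x : ZFSet) → H q' π y → H' q' π y) : Phi R H' p s x := by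
  refine ⟨fun r π q h1 h2 h3 => ?_, fun y q h1 h2 => ?_⟩
  · obtain ⟨q', y, a, b, c⟩ := h.1 r π q h1 h2 h3
    exact ⟨q', y, a, b, hH q q' r π y a h1 b c⟩
  · obtain ⟨q', r, π, a, b, c, d⟩ := h.2 y q h1 h2
    exact ⟨q', r, π, a, b, c, hH q q' r π y a b h1 d⟩

theorem Fc_Phi {R p s x : ↥A} (h : Fc R p s x) : Phi R (Fc R) p s x := by
  obtain ⟨W, h1, h2⟩ := h
  exact Phi_mono (h2 _ _ _ h1) fun q q' r π y _ _ _ h => ⟨W, h, h2⟩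

theorem tr_pair (hZ : SatZFC A id) {T : ↥A} (hTr : TrA T) {s r π : ↥A}
    (hs : (s : ZFSet) ∈ (T : ZFSet)) (h : ZFSet.pair (r : ZFSet) (π : ZFSet) ∈ (s : ZFSet)) :
    (π : ZFSet) ∈ (T : ZFSet) := by
  have h2 := hTr s ⟨_, pair_mem_A hZ r.2 π.2⟩ hs h
  have h3 := hTr _ ⟨_, hZ.pairing _ r.2 _ π.2⟩ h2 (by simp [ZFSet.pair])
  exact hTr _ π h3 (by simp)

theorem Fc_of_Phi (hT : IsTransitiveSet A) (hZ : SatZFC A id) {Q R : ↥A}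
    (hQR : IsForcingPoset Q R) {p s x : ↥A} (hp : (p : ZFSet) ∈ (Q : ZFSet))
    (h : Phi R (Fc R) p s x) : Fc R p s x := by
  obtain ⟨T, hTr, hsT⟩ := exists_tr hT hZ _ (pair_mem_A hZ s.2 x.2)
  have hT1 := hTr ⟨_, pair_mem_A hZ s.2 x.2⟩ ⟨_, hZ.pairing _ s.2 _ x.2⟩ hsT (by simp [ZFSet.pair])
  have hs1 := hTr _ s hT1 (by simp)
  have hx1 := hTr _ x hT1 (by simp)
  obtain ⟨U1, hU1⟩ := prodA hT hZ T T
  obtain ⟨U, hU⟩ := prodA hT hZ Q U1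
  obtain ⟨W0, hW0⟩ := sepA hT hZ (n := 1)
    (fun u v => ∃ a b c : ↥A, (u : ZFSet) = tri a b c ∧ Fc (v 0) a b c)
    (by repeat' first | apply D_F hT hZ | apply D_tri hT hZ | apply D_and | apply D_ex) ![R] U
  have hW : ∀ a b c : ↥A, tri a b c ∈ (W0 : ZFSet) ↔
      ((a : ZFSet) ∈ (Q : ZFSet) ∧ (b : ZFSet) ∈ (T : ZFSet) ∧ (c : ZFSet) ∈ (T : ZFSet)) ∧
        Fc R a b c := by
    intro a b c
    refine (hW0 ⟨_, tri_mem_A hZ a.2 b.2 c.2⟩).trans (and_congr ?_ ?_)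
    · rw [hU]
      constructor
      · rintro ⟨a', u, ha, hu, h⟩
        obtain ⟨b', c', hb, hc, h'⟩ := (hU1 u).1 hu
        simp only [h'] at h
        obtain ⟨e1, e2, e3⟩ := tri_inj.1 h
        exact ⟨e1 ▸ ha, e2 ▸ hb, e3 ▸ hc⟩
      · rintro ⟨ha, hb, hc⟩
        exact ⟨a, ⟨_, pair_mem_A hZ b.2 c.2⟩, ha, (hU1 _).2 ⟨b, c, hb, hc, rfl⟩, rfl⟩
    · constructor
      · rintro ⟨a', b', c', h, h'⟩
        obtain ⟨e1, e2, e3⟩ := tri_inj.1 h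
        rw [Subtype.ext e1, Subtype.ext e2, Subtype.ext e3]
        exact h'
      · intro h
        exact ⟨a, b, c, rfl, h⟩
  obtain ⟨W, hW'⟩ := insA hZ ⟨_, tri_mem_A hZ p.2 s.2 x.2⟩ W0
  refine ⟨W, (hW' _).2 (Or.inl rfl), ?_⟩
  intro p' s' x' h'
  have key : (s' : ZFSet) ∈ (T : ZFSet) ∧ (x' : ZFSet) ∈ (T : ZFSet) ∧ Phi R (Fc R) p' s' x' := by
    rcases (hW' _).1 h' with h' | h'
    · obtain ⟨e1, e2, e3⟩ := tri_inj.1 h'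
      rw [Subtype.ext e1, Subtype.ext e2, Subtype.ext e3]
      exact ⟨hs1, hx1, h⟩
    · obtain ⟨⟨h1, h2, h3⟩, h4⟩ := (hW _ _ _).1 h'
      exact ⟨h2, h3, Fc_Phi h4⟩
  refine Phi_mono key.2.2 fun q q' r π y h1 h2 h3 h4 => (hW' _).2 (Or.inr ((hW _ _ _).2 ⟨⟨?_, ?_, ?_⟩, h4⟩))
  · exact (ZFSet.pair_mem_prod.1 (hQR.sub h1)).1
  · exact tr_pair hZ hTr key.1 h2
  · exact hTr x' y key.2.1 h3

theorem le_left {Q R : ↥A} (hQR : IsForcingPoset Q R) {p q : ↥A} (h : leA R p q) :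
    (p : ZFSet) ∈ (Q : ZFSet) := (ZFSet.pair_mem_prod.1 (hQR.sub h)).1

theorem le_right {Q R : ↥A} (hQR : IsForcingPoset Q R) {p q : ↥A} (h : leA R p q) :
    (q : ZFSet) ∈ (Q : ZFSet) := (ZFSet.pair_mem_prod.1 (hQR.sub h)).2

/-- Downward closure of the forcing relation. -/
theorem Fc_down (hT : IsTransitiveSet A) (hZ : SatZFC A id) {Q R : ↥A}
    (hQR : IsForcingPoset Q R) {p q s x : ↥A} (hqp : leA R q p) (h : Fc R p s x) : Fc R q s x := by
  have hP := Fc_Phi h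
  refine Fc_of_Phi hT hZ hQR (le_left hQR hqp) ⟨fun r π q' h1 h2 h3 => ?_, fun y q' h1 h2 => ?_⟩
  · exact hP.1 r π q' h1 (hQR.trans _ _ _ h2 hqp) h3
  · exact hP.2 y q' h1 (hQR.trans _ _ _ h2 hqp)

/-- Compatible conditions decide the same value. -/
theorem Fc_unique (hT : IsTransitiveSet A) {Q R : ↥A}
    (hQR : IsForcingPoset Q R) (s : ZFSet) : ∀ (hs : s ∈ A) (p p' q x x' : ↥A), leA R q p → leA R q p' →
      Fc R p ⟨s, hs⟩ x → Fc R p' ⟨s, hs⟩ x' → x = x' := by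
  induction s using rankWf.induction with
  | _ s ih =>
  intro hs
  have half : ∀ (p p' q x x' : ↥A), leA R q p → leA R q p' →
      Fc R p ⟨s, hs⟩ x → Fc R p' ⟨s, hs⟩ x' → ∀ y : ↥A, (y : ZFSet) ∈ (x : ZFSet) →
        (y : ZFSet) ∈ (x' : ZFSet) := by
    intro p p' q x x' h1 h2 hF hF' y hy
    obtain ⟨q', r, π, a, b, c, d⟩ := (Fc_Phi hF).2 y q hy h1
    obtain ⟨q'', y', a', b', d'⟩ := (Fc_Phi hF').1 r π q' b (hQR.trans _ _ _ a h2) c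
    have : y = y' := ih π (rank_pair_mem b) π.2 q' q'' q'' y y' a' (hQR.refl _ (le_left hQR a')) d d'
    rwa [this]
  intro p p' q x x' h1 h2 hF hF'
  exact A_ext hT fun z => ⟨half p p' q x x' h1 h2 hF hF' z, half p' p q x' x h2 h1 hF' hF z⟩

/-- A generic filter meets each set in `A` which is dense below one of its members. -/
theorem generic_below (hT : IsTransitiveSet A) (hZ : SatZFC A id) {Q R : ↥A}
    (hQR : IsForcingPoset Q R) {G : Set ZFSet} (hG : IsGenericFilter A Q R G)
    (D : ↥A) (p : ↥A) (hp : (p : ZFSet) ∈ G)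
    (hD : ∀ q : ↥A, leA R q p → ∃ q' : ↥A, leA R q' q ∧ (q' : ZFSet) ∈ (D : ZFSet)) :
    ∃ q : ↥A, (q : ZFSet) ∈ G ∧ (q : ZFSet) ∈ (D : ZFSet) := by
  obtain ⟨E, hE⟩ := sepA hT hZ (n := 3)
    (fun u v => (u : ZFSet) ∈ (v 0 : ZFSet) ∨ ¬ ∃ w : ↥A, leA (v 1) w u ∧ leA (v 1) w (v 2))
    (by repeat' first | apply D_mem | apply D_le hT hZ | apply D_or | apply D_not | apply D_and | apply D_ex)
    ![D, R, p] Q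
  have hE' : ∀ u : ↥A, (u : ZFSet) ∈ (E : ZFSet) ↔ (u : ZFSet) ∈ (Q : ZFSet) ∧
    ((u : ZFSet) ∈ (D : ZFSet) ∨ ¬ ∃ w : ↥A, leA R w u ∧ leA R w p) := hE
  obtain ⟨g, hg, hgE⟩ := hG.generic E E.2 (by
    refine ⟨fun u hu => ((hE' ⟨u, hT _ E.2 _ hu⟩).1 hu).1, fun u hu => ?_⟩
    have huA := hT _ Q.2 _ hu
    by_cases hc : ∃ w : ↥A, leA R w ⟨u, huA⟩ ∧ leA R w p
    · obtain ⟨w, h1, h2⟩ := hc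
      obtain ⟨q', h3, h4⟩ := hD w h2
      exact ⟨q', (hE' q').2 ⟨le_left hQR h3, Or.inl h4⟩, hQR.trans _ _ _ h3 h1⟩
    · exact ⟨u, (hE' ⟨u, huA⟩).2 ⟨hu, Or.inr hc⟩, hQR.refl _ hu⟩)
  have hgA : g ∈ A := hT _ E.2 _ hgE
  rcases ((hE' ⟨g, hgA⟩).1 hgE).2 with h | h
  · exact ⟨⟨g, hgA⟩, hg, h⟩
  · obtain ⟨w, hw, h1, h2⟩ := hG.directed _ hg _ hp
    exact absurd ⟨⟨w, hT _ Q.2 _ (hG.sub hw)⟩, h1, h2⟩ h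

theorem Fc_sound (hT : IsTransitiveSet A) (hZ : SatZFC A id) {Q R : ↥A}
    (hQR : IsForcingPoset Q R) {G : Set ZFSet} (hG : IsGenericFilter A Q R G) (s : ZFSet) :
    ∀ (hs : s ∈ A) (p x : ↥A), (p : ZFSet) ∈ G → Fc R p ⟨s, hs⟩ x → val G s = x := by
  induction s using rankWf.induction with
  | _ s ih =>
  intro hs p x hp hF
  have hP := Fc_Phi hF
  ext z
  rw [mem_val]
  constructor
  · rintro ⟨r, hr, π, hπ, rfl⟩
    have hA := of_pair_mem_A hT (hT _ hs _ hπ)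
    obtain ⟨q, hq, hqp, hqr⟩ := hG.directed _ hp _ hr
    have hqA := hT _ Q.2 _ (hG.sub hq)
    obtain ⟨D, hD⟩ := sepA hT hZ (n := 3)
      (fun u v => ∃ y : ↥A, (y : ZFSet) ∈ (v 0 : ZFSet) ∧ Fc (v 1) u (v 2) y)
      (by repeat' first | apply D_mem | apply D_F hT hZ | apply D_and | apply D_ex)
      ![x, R, ⟨π, hA.2⟩] Q
    have hD' : ∀ u : ↥A, (u : ZFSet) ∈ (D : ZFSet) ↔ (u : ZFSet) ∈ (Q : ZFSet) ∧
      ∃ y : ↥A, (y : ZFSet) ∈ (x : ZFSet) ∧ Fc R u ⟨π, hA.2⟩ y := hD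
    obtain ⟨g, hg, hgD⟩ := generic_below hT hZ hQR hG D ⟨q, hqA⟩ hq (by
      intro q1 hq1
      obtain ⟨q', y, a, b, c⟩ := hP.1 ⟨r, hA.1⟩ ⟨π, hA.2⟩ q1 hπ (hQR.trans _ _ _ hq1 hqp)
        (hQR.trans _ _ _ hq1 hqr)
      exact ⟨q', a, (hD' _).2 ⟨le_left hQR a, y, b, c⟩⟩)
    obtain ⟨-, y, hy, hFy⟩ := (hD' g).1 hgD
    rw [ih π (rank_pair_mem hπ) hA.2 g y hg hFy]
    exact hy
  · intro hz
    have hzA := hT _ x.2 _ hz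
    obtain ⟨D, hD⟩ := sepA hT hZ (n := 3)
      (fun u v => ∃ r π : ↥A, ZFSet.pair (r : ZFSet) (π : ZFSet) ∈ (v 0 : ZFSet) ∧
        leA (v 1) u r ∧ Fc (v 1) u π (v 2))
      (by repeat' first | apply D_pairmem hT hZ | apply D_le hT hZ | apply D_F hT hZ | apply D_and | apply D_ex)
      ![⟨s, hs⟩, R, ⟨z, hzA⟩] Q
    have hD' : ∀ u : ↥A, (u : ZFSet) ∈ (D : ZFSet) ↔ (u : ZFSet) ∈ (Q : ZFSet) ∧
      ∃ r π : ↥A, ZFSet.pair (r : ZFSet) (π : ZFSet) ∈ s ∧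
        leA R u r ∧ Fc R u π ⟨z, hzA⟩ := hD
    obtain ⟨g, hg, hgD⟩ := generic_below hT hZ hQR hG D p hp (by
      intro q1 hq1
      obtain ⟨q', r, π, a, b, c, d⟩ := hP.2 ⟨z, hzA⟩ q1 hz hq1
      exact ⟨q', a, (hD' _).2 ⟨le_left hQR a, r, π, b, c, d⟩⟩)
    obtain ⟨-, r, π, h1, h2, h3⟩ := (hD' g).1 hgD
    exact ⟨r, hG.upward _ hg _ (le_right hQR h2) h2, π, h1,
      (ih π (rank_pair_mem h1) π.2 g ⟨z, hzA⟩ hg h3).symm⟩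

theorem Fc_truth (hT : IsTransitiveSet A) (hZ : SatZFC A id) {Q R : ↥A}
    (hQR : IsForcingPoset Q R) {G : Set ZFSet} (hG : IsGenericFilter A Q R G) (s : ZFSet) :
    ∀ (hs : s ∈ A) (x : ↥A), val G s = x → ∃ p : ↥A, (p : ZFSet) ∈ G ∧ Fc R p ⟨s, hs⟩ x := by
  induction s using rankWf.induction with
  | _ s ih =>
  intro hs x hx
  obtain ⟨D, hD⟩ := sepA hT hZ (n := 3)
    (fun u v => Fc (v 0) u (v 1) (v 2) ∨
      (∃ r π : ↥A, ZFSet.pair (r : ZFSet) (π : ZFSet) ∈ (v 1 : ZFSet) ∧ leA (v 0) u r ∧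
        ∀ q y : ↥A, leA (v 0) q u → (y : ZFSet) ∈ (v 2 : ZFSet) → ¬ Fc (v 0) q π y) ∨
      (∃ y : ↥A, (y : ZFSet) ∈ (v 2 : ZFSet) ∧ ∀ q r π : ↥A, leA (v 0) q u →
        ZFSet.pair (r : ZFSet) (π : ZFSet) ∈ (v 1 : ZFSet) → leA (v 0) q r → ¬ Fc (v 0) q π y))
    (by repeat' first | apply D_mem | apply D_pairmem hT hZ | apply D_le hT hZ | apply D_F hT hZ | apply D_not | apply D_and | apply D_or | apply D_ex | apply D_imp | apply D_all)
    ![R, ⟨s, hs⟩, x] Q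
  have hD' : ∀ u : ↥A, (u : ZFSet) ∈ (D : ZFSet) ↔ (u : ZFSet) ∈ (Q : ZFSet) ∧
     (Fc R u ⟨s, hs⟩ x ∨
      (∃ r π : ↥A, ZFSet.pair (r : ZFSet) (π : ZFSet) ∈ s ∧ leA R u r ∧
        ∀ q y : ↥A, leA R q u → (y : ZFSet) ∈ (x : ZFSet) → ¬ Fc R q π y) ∨
      (∃ y : ↥A, (y : ZFSet) ∈ (x : ZFSet) ∧ ∀ q r π : ↥A, leA R q u →
        ZFSet.pair (r : ZFSet) (π : ZFSet) ∈ s → leA R q r → ¬ Fc R q π y)) := hD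
  obtain ⟨g, hg, hgD⟩ := hG.generic D D.2 (by
    refine ⟨fun u hu => ((hD' ⟨u, hT _ D.2 _ hu⟩).1 hu).1, fun u hu => ?_⟩
    have huA := hT _ Q.2 _ hu
    by_contra hcon
    have hcon' : ∀ q : ↥A, leA R q ⟨u, huA⟩ → (q : ZFSet) ∉ (D : ZFSet) := by
      intro q hq hqD
      exact hcon ⟨q, hqD, hq⟩
    refine hcon' ⟨u, huA⟩ (hQR.refl _ hu) ((hD' _).2 ⟨hu, Or.inl ?_⟩)
    refine Fc_of_Phi hT hZ hQR hu ⟨fun r π q h1 h2 h3 => ?_, fun y q h1 h2 => ?_⟩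
    · by_contra hno
      refine hcon' q h2 ((hD' _).2 ⟨le_left hQR h2, Or.inr (Or.inl ⟨r, π, h1, h3, ?_⟩)⟩)
      intro q' y h4 h5 h6
      exact hno ⟨q', y, h4, h5, h6⟩
    · by_contra hno
      refine hcon' q h2 ((hD' _).2 ⟨le_left hQR h2, Or.inr (Or.inr ⟨y, h1, ?_⟩)⟩)
      intro q' r π h4 h5 h6 h7
      exact hno ⟨q', r, π, h4, h5, h6, h7⟩)
  have hgA : g ∈ A := hT _ D.2 _ hgD
  rcases ((hD' ⟨g, hgA⟩).1 hgD).2 with h | ⟨r, π, h1, h2, h3⟩ | ⟨y, h1, h2⟩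
  · exact ⟨⟨g, hgA⟩, hg, h⟩
  · exfalso
    have hr : (r : ZFSet) ∈ G := hG.upward _ hg _ (le_right hQR h2) h2
    have hm : val G π ∈ (x : ZFSet) := by
      rw [← hx, mem_val]
      exact ⟨r, hr, π, h1, rfl⟩
    obtain ⟨p, hp, hF⟩ := ih π (rank_pair_mem h1) π.2 ⟨_, hT _ x.2 _ hm⟩ rfl
    obtain ⟨w, hw, hw1, hw2⟩ := hG.directed _ hg _ hp
    have hwA := hT _ Q.2 _ (hG.sub hw)
    exact h3 ⟨w, hwA⟩ _ hw1 hm (Fc_down hT hZ hQR (q := ⟨w, hwA⟩) hw2 hF)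
  · exfalso
    have hy := h1
    rw [← hx, mem_val] at hy
    obtain ⟨r, hr, π, hπ, hyπ⟩ := hy
    have hA := of_pair_mem_A hT (hT _ hs _ hπ)
    obtain ⟨p, hp, hF⟩ := ih π (rank_pair_mem hπ) hA.2 y hyπ.symm
    obtain ⟨w, hw, hw1, hw2⟩ := hG.directed _ hg _ hp
    obtain ⟨w', hw', hw1', hw2'⟩ := hG.directed _ hw _ hr
    have hwA := hT _ Q.2 _ (hG.sub hw')
    exact h2 ⟨w', hwA⟩ ⟨r, hA.1⟩ ⟨π, hA.2⟩ (hQR.trans _ _ _ hw1' hw1) hπ hw2'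
      (Fc_down hT hZ hQR (q := ⟨w', hwA⟩) (hQR.trans _ _ _ hw1' hw2) hF)

/-- The membership condition of the mixed name. -/
def MixMem (Q R s z : ↥A) : Prop :=
  ∃ q π p x r : ↥A, (z : ZFSet) = ZFSet.pair q π ∧ Fc R p s x ∧ NmA Q x ∧
    ZFSet.pair (r : ZFSet) (π : ZFSet) ∈ (x : ZFSet) ∧ leA R q p ∧ leA R q r

theorem D_Mix (hT : IsTransitiveSet A) (hZ : SatZFC A id) {n : ℕ} (i j k l : Fin n) :
    Dfn fun v : Fin n → ↥A => MixMem (v i) (v j) (v k) (v l) := by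
  unfold MixMem
  repeat' first | apply D_pair hT hZ | apply D_pairmem hT hZ | apply D_le hT hZ | apply D_F hT hZ | apply D_Nm hT hZ | apply D_and | apply D_ex

theorem exists_mix (hT : IsTransitiveSet A) (hZ : SatZFC A id) {Q R : ↥A}
    (hQR : IsForcingPoset Q R) (s : ↥A) :
    ∃ ρ : ↥A, ∀ z : ↥A, (z : ZFSet) ∈ (ρ : ZFSet) ↔ MixMem Q R s z := by
  obtain ⟨P, hP⟩ := sepA hT hZ (n := 2) (fun p v => ∃ x : ↥A, Fc (v 0) p (v 1) x)
    (by repeat' first | apply D_F hT hZ | apply D_ex) ![R, s] Q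
  have hP' : ∀ p : ↥A, (p : ZFSet) ∈ (P : ZFSet) ↔ (p : ZFSet) ∈ (Q : ZFSet) ∧
    ∃ x : ↥A, Fc R p s x := hP
  obtain ⟨X, hX⟩ := replA hT hZ (n := 2) (fun p x v => Fc (v 0) p (v 1) x)
    (by apply D_F hT hZ) ![R, s] P (by
      intro p hp
      obtain ⟨hpQ, x, hx⟩ := (hP' p).1 hp
      refine ⟨x, hx, fun x' hx' => ?_⟩
      exact Fc_unique hT hQR s s.2 p p p x' x (hQR.refl _ hpQ) (hQR.refl _ hpQ) hx' hx)
  have hX' : ∀ x : ↥A, (x : ZFSet) ∈ (X : ZFSet) ↔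
    ∃ p : ↥A, (p : ZFSet) ∈ (P : ZFSet) ∧ Fc R p s x := hX
  obtain ⟨U, hU⟩ := prodA hT hZ Q ⟨_, hZ.union _ (hZ.union _ (hZ.union _ X.2))⟩
  obtain ⟨ρ, hρ⟩ := sepA hT hZ (n := 3) (fun z v => MixMem (v 0) (v 1) (v 2) z)
    (by apply D_Mix hT hZ) ![Q, R, s] U
  refine ⟨ρ, fun z => (hρ z).trans ⟨fun h => h.2, fun h => ⟨?_, h⟩⟩⟩
  obtain ⟨q, π, p, x, r, h1, h2, h3, h4, h5, h6⟩ := h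
  refine (hU z).2 ⟨q, π, le_left hQR h5, ?_, h1⟩
  have hxX : (x : ZFSet) ∈ (X : ZFSet) := (hX' x).2 ⟨p, (hP' p).2 ⟨le_right hQR h5, x, h2⟩, h2⟩
  simp only [ZFSet.mem_sUnion]
  refine ⟨{(r : ZFSet), (π : ZFSet)}, ⟨ZFSet.pair r π, ⟨x, hxX, h4⟩, ?_⟩, ?_⟩
  · simp [ZFSet.pair]
  · simp

theorem mix_mem_M (hT : IsTransitiveSet A) (hZ : SatZFC A id) {Q R : ↥A}
    (hQR : IsForcingPoset Q R) {M : Set ZFSet} (hM : IsElemSub A id M)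
    (hQM : (Q : ZFSet) ∈ M) (hRM : (R : ZFSet) ∈ M) (s : ↥A) (hs : (s : ZFSet) ∈ M) :
    ∃ ρ : ↥A, (ρ : ZFSet) ∈ M ∧ ∀ z : ↥A, (z : ZFSet) ∈ (ρ : ZFSet) ↔ MixMem Q R s z := by
  have hD : Dfn fun v : Fin 4 → ↥A => ∀ z : ↥A, (z : ZFSet) ∈ (v 0 : ZFSet) ↔
      MixMem (v 1) (v 2) (v 3) z := by
    repeat' first | apply D_mem | apply D_Mix hT hZ | apply D_iff | apply D_all
  obtain ⟨φ, hφ⟩ := hD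
  obtain ⟨ρ, hρ⟩ := exists_mix hT hZ hQR s
  have hv : ∀ i : Fin 3, (![(Q : ZFSet), (R : ZFSet), (s : ZFSet)] : Fin 3 → ZFSet) i ∈ M := by
    intro i
    fin_cases i
    · exact hQM
    · exact hRM
    · exact hs
  obtain ⟨a, ha, h⟩ := hM.tv 3 φ ![(Q : ZFSet), (R : ZFSet), (s : ZFSet)] hv
    ⟨ρ, ρ.2, (hφ _).2 hρ⟩
  exact ⟨⟨a, hM.subset ha⟩, ha, (hφ _).1 h⟩

end

end Paper

open Paper in
/-- Corollary 2.3: in the situation of Lemma 2.2, if `N ≺ A` and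
`M ⊆ N ⊆ M(G) = M[G] ∩ A`, then `N[G] = M[G]`. -/
theorem stmt_11 (A : Set ZFSet) (hT : IsTransitiveSet A) (hZ : SatZFC A id)
    (Q R : ZFSet) (hQR : IsForcingPoset Q R) (hQA : Q ∈ A) (hRA : R ∈ A)
    (M : Set ZFSet) (hM : IsElemSub A id M) (hQM : Q ∈ M) (hRM : R ∈ M)
    (G : Set ZFSet) (hG : IsGenericFilter A Q R G)
    (N : Set ZFSet) (hN : IsElemSub A id N)
    (hMN : M ⊆ N) (hNMG : N ⊆ extModel G Q M ∩ A) :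
    extModel G Q N = extModel G Q M := by
  apply Set.Subset.antisymm
  · rintro z ⟨τ, hτN, hτn, rfl⟩
    obtain ⟨⟨σ, hσM, -, hτσ⟩, hτA⟩ := hNMG hτN
    have hσA := hM.subset hσM
    have hQR' : IsForcingPoset ((⟨Q, hQA⟩ : ↥A) : ZFSet) ((⟨R, hRA⟩ : ↥A) : ZFSet) := hQR
    have hG' : IsGenericFilter A ((⟨Q, hQA⟩ : ↥A) : ZFSet) ((⟨R, hRA⟩ : ↥A) : ZFSet) G := hG
    obtain ⟨ρ, hρM, hρ⟩ := mix_mem_M hT hZ hQR' hM hQM hRM ⟨σ, hσA⟩ hσM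
    obtain ⟨p0, hp0, hF0⟩ := Fc_truth hT hZ hQR' hG' σ hσA ⟨τ, hτA⟩ hτσ.symm
    refine ⟨ρ, hρM, ?_, ?_⟩
    · rw [isName_iff]
      intro z hz
      obtain ⟨q, π, p, x, r, h1, h2, h3, h4, h5, h6⟩ := (hρ ⟨z, hT _ ρ.2 _ hz⟩).1 hz
      refine ⟨q, π, le_left hQR' h5, h1, ?_⟩
      obtain ⟨p', s', -, he, hn⟩ := (isName_iff _ _).1 (isName_of_NmA hT _ x h3) _ h4
      rw [(ZFSet.pair_inj.1 he).2]
      exact hn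
    · ext z
      rw [mem_val, mem_val]
      constructor
      · rintro ⟨r, hr, π, hπ, rfl⟩
        have hA := of_pair_mem_A hT (hT _ hτA _ hπ)
        obtain ⟨q, hq, hq1, hq2⟩ := hG.directed _ hp0 _ hr
        have hqA := hT _ hQA _ (hG.sub hq)
        refine ⟨q, hq, π, (hρ ⟨_, pair_mem_A hZ hqA hA.2⟩).2 ?_, rfl⟩
        exact ⟨⟨q, hqA⟩, ⟨π, hA.2⟩, p0, ⟨τ, hτA⟩, ⟨r, hA.1⟩, rfl, hF0,
          NmA_of_isName hT hZ _ τ hτA hτn, hπ, hq1, hq2⟩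
      · rintro ⟨q, hq, π, hπ, rfl⟩
        have hA := of_pair_mem_A hT (hT _ ρ.2 _ hπ)
        obtain ⟨q', π', p, x, r, h1, h2, h3, h4, h5, h6⟩ := (hρ ⟨_, hT _ ρ.2 _ hπ⟩).1 hπ
        obtain ⟨e1, e2⟩ := ZFSet.pair_inj.1 h1
        have hq' : (q' : ZFSet) ∈ G := e1 ▸ hq
        have hp : (p : ZFSet) ∈ G := hG.upward _ hq' _ (le_right hQR' h5) h5
        have hr : (r : ZFSet) ∈ G := hG.upward _ hq' _ (le_right hQR' h6) h6
        have hx := Fc_sound hT hZ hQR' hG' σ hσA p x hp h2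
        rw [← hτσ] at hx
        exact ⟨r, hr, π, by rw [hx, e2]; exact h4, rfl⟩
  · rintro z ⟨τ, hτ, h⟩
    exact ⟨τ, hMN hτ, h⟩
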